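/- Suppose q ≡ 2 (mod 3). The set of white vectors in U is invariant under multiplication by nonzero scalars of F_q, the number of white vectors in U equals (q^4 + 1)(q^{12} − 1), and hence the number of white points equals (q^4 + 1)(q^{12} − 1)/(q − 1). -/

import Mathlib

/-!  The split octonion algebra `O` over a finite field `F` of order `q`,
represented as `Fin 8 → F` with coordinates with respect to the basis
`x_1, …, x_8` (index `i : Fin 8` corresponds to `x_{i+1}`). -/

variable {F : Type*}

/-- The split octonion multiplication, determined by the table
`x_1x_5 = x_1`, `x_1x_6 = x_2`, `x_1x_7 = −x_3`, `x_1x_8 = −x_4`, `x_2x_3 = −x_1`,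
`x_2x_4 = x_2`, `x_2x_7 = −x_5`, `x_2x_8 = x_6`, `x_3x_2 = x_1`, `x_3x_4 = x_3`,
`x_3x_6 = −x_5`, `x_3x_8 = −x_7` (the sign of `x_3x_8` is forced by `x_8x_3 = x_7` and anti-commutativity of orthogonal imaginary octonions; with it `O` is the split octonion composition algebra), `x_4x_1 = x_1`, `x_4x_4 = x_4`, `x_4x_6 = x_6`,
`x_4x_7 = x_7`, `x_5x_2 = x_2`, `x_5x_3 = x_3`, `x_5x_5 = x_5`, `x_5x_8 = x_8`,
`x_6x_1 = −x_2`, `x_6x_3 = −x_4`, `x_6x_5 = x_6`, `x_6x_7 = x_8`, `x_7x_1 = x_3`,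
`x_7x_2 = −x_4`, `x_7x_5 = x_7`, `x_7x_6 = −x_8`, `x_8x_1 = −x_5`, `x_8x_2 = −x_6`,
`x_8x_3 = x_7`, `x_8x_4 = x_8`, all other products of basis elements being `0`. -/
def octMul [Field F] (a b : Fin 8 → F) : Fin 8 → F :=
  ![a 0 * b 4 - a 1 * b 2 + a 2 * b 1 + a 3 * b 0,
    a 0 * b 5 + a 1 * b 3 + a 4 * b 1 - a 5 * b 0,
    -(a 0 * b 6) + a 2 * b 3 + a 4 * b 2 + a 6 * b 0,
    -(a 0 * b 7) + a 3 * b 3 - a 5 * b 2 - a 6 * b 1,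
    -(a 1 * b 6) - a 2 * b 5 + a 4 * b 4 - a 7 * b 0,
    a 1 * b 7 + a 3 * b 5 + a 5 * b 4 - a 7 * b 1,
    -(a 2 * b 7) + a 3 * b 6 + a 6 * b 4 + a 7 * b 2,
    a 4 * b 7 + a 5 * b 6 - a 6 * b 5 + a 7 * b 3]

/-- The identity `1 = x_4 + x_5` of the octonion algebra. -/
def octOne [Field F] : Fin 8 → F := ![0, 0, 0, 1, 1, 0, 0, 0]

/-- Octonion conjugation: swaps `x_4, x_5` and negates the other basis vectors. -/
def octConj [Field F] (a : Fin 8 → F) : Fin 8 → F :=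
  ![-a 0, -a 1, -a 2, a 4, a 3, -a 5, -a 6, -a 7]

/-- The trace `Tr(Σ λ_i x_i) = λ_4 + λ_5`. -/
def octTr [Field F] (a : Fin 8 → F) : F := a 3 + a 4

/-- The norm `N(Σ λ_i x_i) = λ_1λ_8 + λ_2λ_7 + λ_3λ_6 + λ_4λ_5`. -/
def octN [Field F] (a : Fin 8 → F) : F :=
  a 0 * a 7 + a 1 * a 6 + a 2 * a 5 + a 3 * a 4

/-- The bilinear form `B(x,y) = N(x+y) − N(x) − N(y)`. -/
def octB [Field F] (a b : Fin 8 → F) : F := octN (a + b) - octN a - octN b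

/-- The basis octonion `x_1`. -/
def octX1 [Field F] : Fin 8 → F := ![1, 0, 0, 0, 0, 0, 0, 0]

/-- The 27-dimensional space `A = F × F × F × O × O × O`, whose elements encode the
Hermitian matrices `(λ, λ', λ'' | D, E, F)`. -/
abbrev Alb (F : Type*) := F × F × F × (Fin 8 → F) × (Fin 8 → F) × (Fin 8 → F)

/-- `v ∈ U`, i.e. `v` has trace `λ + λ' + λ'' = 0`. -/
def albInU [Field F] (v : Alb F) : Prop := v.1 + v.2.1 + v.2.2.1 = 0

/-- The quadratic form `Q((λ, λ', λ'' | D, E, F)) = λ² + λλ' + λ'² + N(D) + N(E) + N(F)`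
(on `U`). -/
def albQ [Field F] (v : Alb F) : F :=
  v.1 ^ 2 + v.1 * v.2.1 + v.2.1 ^ 2 +
    octN v.2.2.2.1 + octN v.2.2.2.2.1 + octN v.2.2.2.2.2

/-- The polar form `B_Q(u, v) = Q(u + v) − Q(u) − Q(v)`. -/
def albB [Field F] (u v : Alb F) : F := albQ (u + v) - albQ u - albQ v

/-- A vector of `U` is *white* if it has one of the forms (I), (II), (III). -/
def IsWhite [Field F] (v : Alb F) : Prop :=
  (∃ f : F, f ≠ 0 ∧ ∃ A B : Fin 8 → F, octN A + octN B + 1 = 0 ∧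
    v = (f * octN A, f * octN B, f, f • octConj B, f • A, f • octMul (octConj A) B)) ∨
  (∃ e : F, e ≠ 0 ∧ ∃ A C : Fin 8 → F, octN A = 0 ∧ octN C + 1 = 0 ∧
    v = (e * octN C, e, 0, e • A, e • octConj (octMul C A), e • C)) ∨
  (∃ D E G : Fin 8 → F, ¬(D = 0 ∧ E = 0 ∧ G = 0) ∧
    octN D = 0 ∧ octN E = 0 ∧ octN G = 0 ∧
    octMul D E = 0 ∧ octMul E G = 0 ∧ octMul G D = 0 ∧
    v = (0, 0, 0, D, E, G))

/-- The set of white points: the `1`-dimensional subspaces spanned by white vectors. -/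
def whitePoints (F : Type*) [Field F] : Set (Submodule F (Alb F)) :=
  {P | ∃ v : Alb F, IsWhite v ∧ P = Submodule.span F {v}}

theorem octMul_octConj_add [Field F] (a b v : Fin 8 → F) :
    octMul a (octMul (octConj b) v) + octMul b (octMul (octConj a) v) = octB a b • v := by
  ext i
  fin_cases i <;> simp [octMul, octConj, octB, octN] <;> ring

theorem octMul_octMul_octConj_self [Field F] (a v : Fin 8 → F) :
    octMul a (octMul (octConj a) v) = octN a • v := by
  ext i
  fin_cases i <;> simp [octMul, octConj, octN] <;> ring

theorem octMul_octMul_octConj_right [Field F] (a v : Fin 8 → F) :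
    octMul (octMul v a) (octConj a) = octN a • v := by
  ext i
  fin_cases i <;> simp [octMul, octConj, octN] <;> ring

theorem octConj_octConj [Field F] (a : Fin 8 → F) : octConj (octConj a) = a := by
  ext i
  fin_cases i <;> simp [octConj]

theorem octConj_octMul [Field F] (a b : Fin 8 → F) :
    octConj (octMul a b) = octMul (octConj b) (octConj a) := by
  ext i
  fin_cases i <;> simp [octMul, octConj] <;> ring

theorem octN_octConj [Field F] (a : Fin 8 → F) : octN (octConj a) = octN a := by
  simp [octN, octConj]; ring

/-- A consequence of the Moufang identity `((ȳ d) z) d = ȳ (d z d)`. -/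
theorem octMul_moufang [Field F] (d y z : Fin 8 → F) :
    octMul (octMul (octConj (octMul (octConj d) y)) z) d =
      octB d (octConj z) • octConj (octMul (octConj d) y) -
        octN d • octMul (octConj y) (octConj z) := by
  ext i
  fin_cases i <;> simp [octMul, octConj, octB, octN] <;> ring

/-- Left multiplication by an octonion as a linear map. -/
def octMulLeft [Field F] (a : Fin 8 → F) : (Fin 8 → F) →ₗ[F] (Fin 8 → F) where
  toFun := octMul a
  map_add' x y := by ext i; fin_cases i <;> simp [octMul] <;> ring
  map_smul' c x := by ext i; fin_cases i <;> simp [octMul] <;> ring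

/-- The polar form of the octonion norm as a bilinear form. -/
def octBilin [Field F] : LinearMap.BilinForm F (Fin 8 → F) :=
  LinearMap.mk₂ F octB
    (fun x y z => by simp [octB, octN]; ring) (fun c x y => by simp [octB, octN]; ring)
    (fun x y z => by simp [octB, octN]; ring) (fun c x y => by simp [octB, octN]; ring)

theorem octConj_zero [Field F] : octConj (0 : Fin 8 → F) = 0 := by
  ext i
  fin_cases i <;> simp [octConj]

theorem octMul_zero_left [Field F] (a : Fin 8 → F) : octMul 0 a = 0 := by
  ext i
  fin_cases i <;> simp [octMul]

theorem octMul_zero_right [Field F] (a : Fin 8 → F) : octMul a 0 = 0 :=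
  (octMulLeft a).map_zero

theorem octN_zero [Field F] : octN (0 : Fin 8 → F) = 0 := by
  simp [octN]

theorem octConj_eq_zero_iff [Field F] {a : Fin 8 → F} : octConj a = 0 ↔ a = 0 := by
  constructor
  · intro h
    rw [← octConj_octConj a, h, octConj_zero]
  · rintro rfl
    exact octConj_zero

theorem octN_right_eq_zero_of_octMul_eq_zero [Field F] {a b : Fin 8 → F} (ha : a ≠ 0)
    (h : octMul a b = 0) : octN b = 0 := by
  have := octMul_octMul_octConj_right b a
  rw [h, octMul_zero_left] at this
  exact (smul_eq_zero.mp this.symm).resolve_right ha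

theorem octBilin_nondegenerate [Field F] : (octBilin (F := F)).Nondegenerate := by
  have hsymm : (octBilin (F := F)).IsSymm :=
    ⟨fun x y => by simp [octBilin, octB, octN]; ring⟩
  refine hsymm.isRefl.nondegenerate_iff_separatingLeft.mpr fun x hx => ?_
  ext i
  have := hx (Pi.single (Fin.rev i) 1)
  fin_cases i <;>
    simpa [octBilin, octB, octN, Fin.rev, Pi.single_apply, mul_add, add_mul] using this

theorem exists_octB_eq_one [Field F] {a : Fin 8 → F} (ha : a ≠ 0) : ∃ z, octB a z = 1 := by
  by_contra! h
  refine ha (octBilin_nondegenerate.1 a fun z => ?_)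
  by_contra hz
  refine h ((octBilin a z)⁻¹ • z) ?_
  change octBilin a _ = 1
  rw [map_smul, smul_eq_mul, inv_mul_cancel₀ hz]

theorem octMulLeft_apply [Field F] (a b : Fin 8 → F) : octMulLeft a b = octMul a b := rfl

theorem ker_octMulLeft [Field F] {a : Fin 8 → F} (ha : a ≠ 0) (hN : octN a = 0) :
    (octMulLeft a).ker = (octMulLeft (octConj a)).range := by
  obtain ⟨z, hz⟩ := exists_octB_eq_one (octConj_eq_zero_iff.not.mpr ha)
  ext v
  simp only [LinearMap.mem_ker, LinearMap.mem_range, octMulLeft_apply]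
  constructor
  · intro hv
    have := octMul_octConj_add (octConj a) z v
    rw [octConj_octConj, hv, octMul_zero_right, add_zero, hz, one_smul] at this
    exact ⟨_, this⟩
  · rintro ⟨y, rfl⟩
    rw [octMul_octMul_octConj_self, hN, zero_smul]

theorem finrank_ker_octMulLeft_le [Field F] {a : Fin 8 → F} (ha : a ≠ 0) :
    Module.finrank F (octMulLeft a).ker ≤ 4 := by
  have hle : (octMulLeft a).ker ≤ octBilin.orthogonal (octMulLeft a).ker := by
    intro x hx y hy
    have hN : ∀ v ∈ (octMulLeft a).ker, octN v = 0 :=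
      fun v hv => octN_right_eq_zero_of_octMul_eq_zero ha hv
    change octB y x = 0
    rw [octB, hN _ (add_mem hy hx), hN _ hx, hN _ hy]
    simp
  have h1 := Submodule.finrank_mono hle
  rw [LinearMap.BilinForm.finrank_orthogonal octBilin_nondegenerate] at h1
  have h2 : Module.finrank F (Fin 8 → F) = 8 := by simp
  omega

theorem finrank_ker_octMulLeft [Field F] {a : Fin 8 → F} (ha : a ≠ 0) (hN : octN a = 0) :
    Module.finrank F (octMulLeft a).ker = 4 := by
  have ha' := octConj_eq_zero_iff.not.mpr ha
  have h1 := finrank_ker_octMulLeft_le ha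
  have h2 := finrank_ker_octMulLeft_le ha'
  have h3 := (octMulLeft (octConj a)).finrank_range_add_finrank_ker
  rw [← ker_octMulLeft ha hN] at h3
  have h4 : Module.finrank F (Fin 8 → F) = 8 := by simp
  omega

theorem ncard_octMul_left_eq_zero [Field F] [Fintype F] {a : Fin 8 → F} (ha : a ≠ 0)
    (hN : octN a = 0) : {b | octMul a b = 0}.ncard = Fintype.card F ^ 4 := by
  have := Module.natCard_eq_pow_finrank (K := F) (V := (octMulLeft a).ker)
  rw [finrank_ker_octMulLeft ha hN, Nat.card_eq_fintype_card (α := F)] at this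
  exact this

theorem ncard_octMul_right_eq_zero [Field F] [Fintype F] {a : Fin 8 → F} (ha : a ≠ 0)
    (hN : octN a = 0) : {b | octMul b a = 0}.ncard = Fintype.card F ^ 4 := by
  rw [← ncard_octMul_left_eq_zero (octConj_eq_zero_iff.not.mpr ha) ((octN_octConj a).trans hN)]
  refine Set.ncard_congr (fun b _ => octConj b) ?_ ?_ ?_
  · intro b hb
    simpa [← octConj_octMul] using octConj_eq_zero_iff.mpr hb
  · intro b c _ _ h
    simpa [octConj_octConj] using congrArg octConj h
  · intro b hb
    refine ⟨octConj b, ?_, octConj_octConj b⟩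
    have := octConj_eq_zero_iff.mpr hb
    rwa [octConj_octMul, octConj_octConj] at this

/-- The number of preimages of a point under a nonzero linear functional. -/
theorem ncard_linearMap_fiber_mul_card [Field F] {W : Type*} [AddCommGroup W]
    [Module F W] (l : W →ₗ[F] F) {w : W} (hw : l w = 1) (c : F) :
    {v | l v = c}.ncard * Nat.card F = Nat.card W := by
  rw [← Nat.card_coe_set_eq, ← Nat.card_prod]
  refine Nat.card_congr
    { toFun := fun p => p.1 + p.2 • w
      invFun := fun v => (⟨v - (l v - c) • w, by simp [hw]⟩, l v - c)
      left_inv := ?_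
      right_inv := ?_ }
  · rintro ⟨⟨v, hv⟩, t⟩
    simp only [Set.mem_ofPred_eq] at hv
    simp [hw, hv]
  · intro v
    simp

/-- For nonzero `a`, `b` of norm zero with `ab = 0`, the right annihilator of `b` and the left
annihilator of `a` meet in a `3`-dimensional space. -/
theorem ncard_octMul_octMul_eq_zero [Field F] [Fintype F] {a b : Fin 8 → F} (ha : a ≠ 0)
    (hb : b ≠ 0) (hNa : octN a = 0) (hNb : octN b = 0) (hab : octMul a b = 0) :
    {g | octMul b g = 0 ∧ octMul g a = 0}.ncard = Fintype.card F ^ 3 := by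
  have hb' := octConj_eq_zero_iff.not.mpr hb
  obtain ⟨y, hy⟩ : b ∈ (octMulLeft (octConj a)).range := ker_octMulLeft ha hNa ▸ hab
  rw [octMulLeft_apply] at hy
  have key : ∀ z, octMul (octMul (octConj b) z) a = octB a (octConj z) • octConj b := by
    intro z
    rw [← hy, octMul_moufang, hNa, zero_smul, sub_zero]
  let L := octMulLeft (octConj b)
  let l : (Fin 8 → F) →ₗ[F] F :=
    { toFun := fun z => octB a (octConj z)
      map_add' := fun x y => by simp [octB, octN, octConj]; ring
      map_smul' := fun c x => by simp [octB, octN, octConj]; ring }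
  have hl : ∀ z, l z = octB a (octConj z) := fun _ => rfl
  have hS : {g | octMul b g = 0 ∧ octMul g a = 0} = (l.ker.map L : Set (Fin 8 → F)) := by
    ext g
    simp only [Set.mem_ofPred_eq, SetLike.mem_coe, Submodule.mem_map, LinearMap.mem_ker, hl]
    constructor
    · rintro ⟨hbg, hga⟩
      obtain ⟨z, rfl⟩ : g ∈ L.range := ker_octMulLeft hb hNb ▸ hbg
      exact ⟨z, (smul_eq_zero.mp ((key z).symm.trans hga)).resolve_right hb', rfl⟩
    · rintro ⟨z, hz, rfl⟩
      refine ⟨?_, ?_⟩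
      · rw [octMulLeft_apply, octMul_octMul_octConj_self, hNb, zero_smul]
      · rw [octMulLeft_apply, key, hz, zero_smul]
  have hLl : L.ker ≤ l.ker := by
    intro z hz
    have := key z
    rw [show octMul (octConj b) z = 0 from hz, octMul_zero_left] at this
    exact (smul_eq_zero.mp this.symm).resolve_right hb'
  have hrange : l.range = ⊤ := by
    obtain ⟨z, hz⟩ := exists_octB_eq_one ha
    refine LinearMap.range_eq_top.mpr fun c => ⟨c • octConj z, ?_⟩
    rw [map_smul, hl, octConj_octConj, hz, smul_eq_mul, mul_one]
  have h1 := l.finrank_range_add_finrank_ker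
  have h2 := (L.domRestrict l.ker).finrank_range_add_finrank_ker
  rw [LinearMap.range_domRestrict, LinearMap.ker_domRestrict,
    (Submodule.comapSubtypeEquivOfLe hLl).finrank_eq,
    finrank_ker_octMulLeft hb' ((octN_octConj b).trans hNb)] at h2
  rw [hrange, finrank_top, Module.finrank_self] at h1
  have h3 : Module.finrank F (Fin 8 → F) = 8 := by simp
  have h4 : Module.finrank F (l.ker.map L) = 3 := by omega
  have h5 := Module.natCard_eq_pow_finrank (K := F) (V := l.ker.map L)
  rw [h4, Nat.card_eq_fintype_card (α := F)] at h5
  rw [hS]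
  exact h5

theorem ncard_setOf_prod {α β : Type*} [Fintype α] [Finite β] (P : α → β → Prop) :
    {p : α × β | P p.1 p.2}.ncard = ∑ a, {b | P a b}.ncard := by
  simp only [← Nat.card_coe_set_eq]
  rw [← Nat.card_sigma]
  exact Nat.card_congr
    { toFun := fun p => ⟨p.1.1, p.1.2, p.2⟩
      invFun := fun p => ⟨(p.1, p.2.1), p.2.2⟩
      left_inv := fun _ => rfl
      right_inv := fun _ => rfl }

/-- The sum of a function that is constant on `S \ {a}` and zero off `S`. -/
theorem sum_add_eq_of_const_off {α : Type*} [Fintype α] (f : α → ℕ) (S : Set α) {a : α} {m : ℕ}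
    (ha : a ∈ S) (hS : ∀ b ∈ S, b ≠ a → f b = m) (hnS : ∀ b ∉ S, f b = 0) :
    ∑ b, f b + m = f a + S.ncard * m := by
  classical
  have h1 : ∑ b, f b = ∑ b ∈ S.toFinset, f b :=
    (Finset.sum_subset (Finset.subset_univ _) fun b _ hb => hnS b (by simpa using hb)).symm
  have ha' : a ∈ S.toFinset := by simpa using ha
  rw [h1, ← Finset.add_sum_erase _ _ ha', Finset.sum_congr rfl (g := fun _ => m),
    Finset.sum_const, smul_eq_mul, add_assoc, ← Nat.succ_mul, Nat.succ_eq_add_one,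
    Finset.card_erase_add_one ha', Set.ncard_eq_toFinset_card']
  intro b hb
  rw [Finset.mem_erase] at hb
  exact hS b (by simpa using hb.2) hb.1

theorem ncard_dotProduct_eq_add [Field F] [Fintype F] [DecidableEq F] (c : F) :
    {p : (Fin 4 → F) × (Fin 4 → F) | p.1 ⬝ᵥ p.2 = c}.ncard + Fintype.card F ^ 3 =
      Fintype.card F ^ 7 + if c = 0 then Fintype.card F ^ 4 else 0 := by
  have hq : 0 < Fintype.card F := Fintype.card_pos
  rw [ncard_setOf_prod (fun x y : Fin 4 → F => x ⬝ᵥ y = c),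
    sum_add_eq_of_const_off _ Set.univ (Set.mem_univ (0 : Fin 4 → F)) (fun x _ hx => ?_)
      (fun x hx => absurd (Set.mem_univ x) hx), Set.ncard_univ, Nat.card_eq_fintype_card,
      Fintype.card_pi_const, ← pow_add, add_comm]
  · congr 1
    by_cases hc : c = 0
    · simp [hc, Set.ncard_univ]
    · simp [hc, Ne.symm hc]
  · obtain ⟨i, hi⟩ := Function.ne_iff.mp hx
    have := ncard_linearMap_fiber_mul_card (dotProductBilin F F x) (w := Pi.single i (x i)⁻¹)
      (by simpa using mul_inv_cancel₀ hi) c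
    rw [Nat.card_eq_fintype_card, Nat.card_eq_fintype_card, Fintype.card_pi_const] at this
    refine Nat.eq_of_mul_eq_mul_right hq (this.trans (pow_succ _ 3))

theorem ncard_octN_eq_add [Field F] [Fintype F] [DecidableEq F] (c : F) :
    {a : Fin 8 → F | octN a = c}.ncard + Fintype.card F ^ 3 =
      Fintype.card F ^ 7 + if c = 0 then Fintype.card F ^ 4 else 0 := by
  rw [← ncard_dotProduct_eq_add]
  congr 1
  symm
  refine Set.ncard_congr
    (fun p _ => ![p.1 0, p.1 1, p.1 2, p.1 3, p.2 3, p.2 2, p.2 1, p.2 0]) ?_ ?_ ?_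
  · intro p hp
    simpa [octN, dotProduct, Fin.sum_univ_four] using hp
  · rintro ⟨x, y⟩ ⟨x', y'⟩ - - h
    simp only [Matrix.vecCons_inj] at h
    ext i <;> fin_cases i <;> simp [h]
  · intro a ha
    refine ⟨(![a 0, a 1, a 2, a 3], ![a 7, a 6, a 5, a 4]), ?_, ?_⟩
    · simpa [octN, dotProduct, Fin.sum_univ_four] using ha
    · ext i
      fin_cases i <;> rfl

theorem ncard_octN_eq_zero_add [Field F] [Fintype F] :
    {a : Fin 8 → F | octN a = 0}.ncard + Fintype.card F ^ 3 =
      Fintype.card F ^ 7 + Fintype.card F ^ 4 := by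
  classical
  simpa using ncard_octN_eq_add (0 : F)

theorem ncard_octN_eq_add_of_ne_zero [Field F] [Fintype F] {c : F} (hc : c ≠ 0) :
    {a : Fin 8 → F | octN a = c}.ncard + Fintype.card F ^ 3 = Fintype.card F ^ 7 := by
  classical
  simpa [hc] using ncard_octN_eq_add c

theorem ncard_octN_add_octN_eq_add [Field F] [Fintype F] {c : F} (hc : c ≠ 0) :
    {p : (Fin 8 → F) × (Fin 8 → F) | octN p.1 + octN p.2 = c}.ncard + Fintype.card F ^ 7 =
      Fintype.card F ^ 15 := by
  classical
  have h : ∑ a : Fin 8 → F, ({b | octN a + octN b = c}.ncard + Fintype.card F ^ 3) =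
      ∑ a : Fin 8 → F, (Fintype.card F ^ 7 + if octN a = c then Fintype.card F ^ 4 else 0) := by
    refine Finset.sum_congr rfl fun a _ => ?_
    have := ncard_octN_eq_add (c - octN a)
    simp only [eq_sub_iff_add_eq', sub_eq_zero] at this
    rw [this]
    simp only [eq_comm]
  have hcard : {a : Fin 8 → F | octN a = c}.ncard = Finset.card {a : Fin 8 → F | octN a = c} := by
    rw [← Set.ncard_coe_finset]
    simp
  rw [Finset.sum_add_distrib, Finset.sum_add_distrib, ← Finset.sum_filter, Finset.sum_const,
    Finset.sum_const, Finset.sum_const, ← hcard, ← ncard_setOf_prod] at h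
  simp only [Finset.card_univ, Fintype.card_pi_const, smul_eq_mul] at h
  have h2 := ncard_octN_eq_add_of_ne_zero hc
  zify at h h2 ⊢
  linear_combination h + (Fintype.card F : ℤ) ^ 4 * h2

/-- The defining condition of the white vectors of the third form, without nonvanishing. -/
def IsAnnihilatingTriple [Field F] (D E G : Fin 8 → F) : Prop :=
  octN D = 0 ∧ octN E = 0 ∧ octN G = 0 ∧ octMul D E = 0 ∧ octMul E G = 0 ∧ octMul G D = 0

theorem octN_left_eq_zero_of_octMul_eq_zero [Field F] {a b : Fin 8 → F} (ha : a ≠ 0)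
    (h : octMul b a = 0) : octN b = 0 := by
  have := octMul_octMul_octConj_self (octConj b) a
  rw [octConj_octConj, h, octMul_zero_right, octN_octConj] at this
  exact (smul_eq_zero.mp this.symm).resolve_right ha

theorem ncard_isAnnihilatingTriple_of_ne_zero [Field F] [Fintype F] {D : Fin 8 → F}
    (hD : D ≠ 0) (hND : octN D = 0) :
    {p : (Fin 8 → F) × (Fin 8 → F) | IsAnnihilatingTriple D p.1 p.2}.ncard + Fintype.card F ^ 3 =
      Fintype.card F ^ 4 + Fintype.card F ^ 4 * Fintype.card F ^ 3 := by
  rw [ncard_setOf_prod, sum_add_eq_of_const_off _ {E | octMul D E = 0} (a := 0)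
    (octMul_zero_right D) (fun E hE hE0 => ?_) (fun E hE => ?_), ncard_octMul_left_eq_zero hD hND]
  · congr 1
    rw [← ncard_octMul_right_eq_zero hD hND]
    congr 1
    ext G
    simp only [IsAnnihilatingTriple, Set.mem_ofPred_eq, hND, octN_zero, octMul_zero_left,
      octMul_zero_right, true_and, and_iff_right_iff_imp]
    exact octN_left_eq_zero_of_octMul_eq_zero hD
  · have hNE := octN_right_eq_zero_of_octMul_eq_zero hD hE
    rw [← ncard_octMul_octMul_eq_zero hD hE0 hND hNE hE]
    congr 1
    ext G
    simp only [IsAnnihilatingTriple, Set.mem_ofPred_eq, hND, hNE, show octMul D E = 0 from hE,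
      true_and, and_iff_right_iff_imp]
    exact fun h => octN_left_eq_zero_of_octMul_eq_zero hD h.2
  · rw [Set.ncard_eq_zero]
    exact Set.eq_empty_of_forall_notMem fun G hG => hE hG.2.2.2.1

theorem ncard_isAnnihilatingTriple_zero [Field F] [Fintype F] :
    {p : (Fin 8 → F) × (Fin 8 → F) | IsAnnihilatingTriple 0 p.1 p.2}.ncard + Fintype.card F ^ 4 =
      {a : Fin 8 → F | octN a = 0}.ncard +
        {a : Fin 8 → F | octN a = 0}.ncard * Fintype.card F ^ 4 := by
  rw [ncard_setOf_prod, sum_add_eq_of_const_off _ {E | octN E = 0} (a := 0)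
    octN_zero (fun E hE hE0 => ?_) (fun E hE => ?_)]
  · simp [IsAnnihilatingTriple, octN_zero, octMul_zero_left, octMul_zero_right]
  · rw [← ncard_octMul_left_eq_zero hE0 hE]
    congr 1
    ext G
    simp only [IsAnnihilatingTriple, Set.mem_ofPred_eq, octN_zero, octMul_zero_left,
      octMul_zero_right, show octN E = 0 from hE, true_and, and_true, and_iff_right_iff_imp]
    exact octN_right_eq_zero_of_octMul_eq_zero hE0
  · rw [Set.ncard_eq_zero]
    exact Set.eq_empty_of_forall_notMem fun G hG => hE hG.2.1

theorem ncard_isAnnihilatingTriple [Field F] [Fintype F] :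
    ({p : (Fin 8 → F) × (Fin 8 → F) × (Fin 8 → F) |
      IsAnnihilatingTriple p.1 p.2.1 p.2.2}.ncard : ℤ) =
      (Fintype.card F : ℤ) ^ 14 + 3 * (Fintype.card F : ℤ) ^ 11 - 2 * (Fintype.card F : ℤ) ^ 10 +
        2 * (Fintype.card F : ℤ) ^ 8 - 3 * (Fintype.card F : ℤ) ^ 7 + (Fintype.card F : ℤ) ^ 6 -
        (Fintype.card F : ℤ) ^ 4 := by
  have hle : Fintype.card F ^ 3 ≤ Fintype.card F ^ 4 :=
    Nat.pow_le_pow_right Fintype.card_pos (by norm_num)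
  have h := sum_add_eq_of_const_off
    (fun D : Fin 8 → F =>
      {p : (Fin 8 → F) × (Fin 8 → F) | IsAnnihilatingTriple D p.1 p.2}.ncard)
    {D | octN D = 0} (a := 0) octN_zero
    (m := Fintype.card F ^ 4 + Fintype.card F ^ 4 * Fintype.card F ^ 3 - Fintype.card F ^ 3)
    (fun D hD hD0 => by rw [← ncard_isAnnihilatingTriple_of_ne_zero hD0 hD]; simp)
    (fun D hD => by
      rw [Set.ncard_eq_zero]
      exact Set.eq_empty_of_forall_notMem fun G hG => hD hG.1)
  rw [← ncard_setOf_prod (fun D (p : (Fin 8 → F) × (Fin 8 → F)) =>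
    IsAnnihilatingTriple D p.1 p.2)] at h
  have h0 := ncard_isAnnihilatingTriple_zero (F := F)
  have hn := ncard_octN_eq_zero_add (F := F)
  zify [hle.trans (Nat.le_add_right _ (Fintype.card F ^ 4 * Fintype.card F ^ 3))] at h h0 hn
  generalize (Fintype.card F : ℤ) = q at *
  linear_combination h + h0 + (1 + q ^ 4 + (q ^ 4 + q ^ 4 * q ^ 3 - q ^ 3)) * hn

theorem octN_smul [Field F] (c : F) (a : Fin 8 → F) : octN (c • a) = c ^ 2 * octN a := by
  simp [octN]; ring

theorem octMul_smul_smul [Field F] (c : F) (a b : Fin 8 → F) :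
    octMul (c • a) (c • b) = c ^ 2 • octMul a b := by
  ext i
  fin_cases i <;> simp [octMul] <;> ring

theorem IsAnnihilatingTriple.smul [Field F] {D E G : Fin 8 → F} (h : IsAnnihilatingTriple D E G)
    (c : F) : IsAnnihilatingTriple (c • D) (c • E) (c • G) := by
  obtain ⟨h1, h2, h3, h4, h5, h6⟩ := h
  simp only [IsAnnihilatingTriple, octN_smul, octMul_smul_smul, h1, h2, h3, h4, h5, h6, mul_zero,
    smul_zero, and_self]

theorem IsWhite.smul [Field F] {c : F} (hc : c ≠ 0) {v : Alb F} (hv : IsWhite v) :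
    IsWhite (c • v) := by
  obtain ⟨f, hf, A, B, h, rfl⟩ | ⟨e, he, A, C, hA, hC, rfl⟩ |
    ⟨D, E, G, h0, h1, h2, h3, h4, h5, h6, rfl⟩ := hv
  · exact Or.inl ⟨c * f, mul_ne_zero hc hf, A, B, h, by simp [mul_assoc, mul_smul]⟩
  · exact Or.inr (Or.inl ⟨c * e, mul_ne_zero hc he, A, C, hA, hC,
      by simp [mul_assoc, mul_smul]⟩)
  · obtain ⟨h1, h2, h3, h4, h5, h6⟩ := IsAnnihilatingTriple.smul ⟨h1, h2, h3, h4, h5, h6⟩ c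
    exact Or.inr (Or.inr ⟨c • D, c • E, c • G, by simpa [hc] using h0, h1, h2, h3, h4, h5, h6,
      by simp⟩)

theorem IsWhite.ne_zero [Field F] {v : Alb F} (hv : IsWhite v) : v ≠ 0 := by
  obtain ⟨f, hf, A, B, h, rfl⟩ | ⟨e, he, A, C, hA, hC, rfl⟩ |
    ⟨D, E, G, h0, h1, h2, h3, h4, h5, h6, rfl⟩ := hv
  · simp [Prod.ext_iff, hf]
  · simp [Prod.ext_iff, he]
  · simpa [Prod.ext_iff] using h0

/-- Vectors of the first white form, from their parameters. -/
def whiteVectorOne [Field F] (p : F × (Fin 8 → F) × (Fin 8 → F)) : Alb F :=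
  (p.1 * octN p.2.1, p.1 * octN p.2.2, p.1, p.1 • octConj p.2.2, p.1 • p.2.1,
    p.1 • octMul (octConj p.2.1) p.2.2)

/-- Vectors of the second white form, from their parameters. -/
def whiteVectorTwo [Field F] (p : F × (Fin 8 → F) × (Fin 8 → F)) : Alb F :=
  (p.1 * octN p.2.2, p.1, 0, p.1 • p.2.1, p.1 • octConj (octMul p.2.2 p.2.1), p.1 • p.2.2)

/-- Vectors of the third white form, from their parameters. -/
def whiteVectorThree [Field F] (p : (Fin 8 → F) × (Fin 8 → F) × (Fin 8 → F)) : Alb F :=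
  (0, 0, 0, p)

theorem setOf_isWhite [Field F] :
    {v : Alb F | IsWhite v} =
      whiteVectorOne '' ({f | f ≠ 0} ×ˢ {p | octN p.1 + octN p.2 = -1}) ∪
      (whiteVectorTwo '' ({e | e ≠ 0} ×ˢ {A | octN A = 0} ×ˢ {C | octN C = -1}) ∪
        whiteVectorThree '' ({p | IsAnnihilatingTriple p.1 p.2.1 p.2.2} \ {0})) := by
  ext v
  simp only [IsWhite, Set.mem_ofPred_eq, Set.mem_union, Set.mem_image, Set.mem_prod, Set.mem_sdiff,
    Set.mem_singleton_iff, eq_neg_iff_add_eq_zero]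
  refine or_congr ?_ (or_congr ?_ ?_)
  · constructor
    · rintro ⟨f, hf, A, B, h, rfl⟩
      exact ⟨(f, A, B), ⟨hf, h⟩, rfl⟩
    · rintro ⟨⟨f, A, B⟩, ⟨hf, h⟩, rfl⟩
      exact ⟨f, hf, A, B, h, rfl⟩
  · constructor
    · rintro ⟨e, he, A, C, hA, hC, rfl⟩
      exact ⟨(e, A, C), ⟨he, hA, hC⟩, rfl⟩
    · rintro ⟨⟨e, A, C⟩, ⟨he, hA, hC⟩, rfl⟩
      exact ⟨e, he, A, C, hA, hC, rfl⟩
  · constructor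
    · rintro ⟨D, E, G, h0, h1, h2, h3, h4, h5, h6, rfl⟩
      exact ⟨(D, E, G), ⟨⟨h1, h2, h3, h4, h5, h6⟩, by simpa [Prod.ext_iff] using h0⟩, rfl⟩
    · rintro ⟨⟨D, E, G⟩, ⟨⟨h1, h2, h3, h4, h5, h6⟩, h0⟩, rfl⟩
      exact ⟨D, E, G, by simpa [Prod.ext_iff] using h0, h1, h2, h3, h4, h5, h6, rfl⟩

theorem ncard_ne_zero [Field F] [Fintype F] : {f : F | f ≠ 0}.ncard = Fintype.card F - 1 := by
  rw [← Set.compl_singleton_eq, Set.ncard_compl, Set.ncard_singleton, Nat.card_eq_fintype_card]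

theorem injOn_whiteVectorOne [Field F] (S : Set ((Fin 8 → F) × (Fin 8 → F))) :
    Set.InjOn whiteVectorOne ({f | f ≠ 0} ×ˢ S) := by
  rintro ⟨f, A, B⟩ ⟨hf, -⟩ ⟨f', A', B'⟩ - h
  simp only [whiteVectorOne, Prod.mk.injEq] at h
  obtain ⟨-, -, rfl, hB, hA, -⟩ := h
  have hB := congrArg octConj (smul_right_injective _ hf hB)
  rw [octConj_octConj, octConj_octConj] at hB
  rw [smul_right_injective _ hf hA, hB]

theorem injOn_whiteVectorTwo [Field F] (S : Set ((Fin 8 → F) × (Fin 8 → F))) :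
    Set.InjOn whiteVectorTwo ({f | f ≠ 0} ×ˢ S) := by
  rintro ⟨f, A, B⟩ ⟨hf, -⟩ ⟨f', A', B'⟩ - h
  simp only [whiteVectorTwo, Prod.mk.injEq] at h
  obtain ⟨-, rfl, -, hA, -, hB⟩ := h
  rw [smul_right_injective _ hf hA, smul_right_injective _ hf hB]

theorem injective_whiteVectorThree [Field F] :
    Function.Injective (whiteVectorThree (F := F)) := by
  intro p p' h
  simpa [whiteVectorThree] using h

theorem ncard_isWhite [Field F] [Fintype F] :
    {v : Alb F | IsWhite v}.ncard = (Fintype.card F ^ 4 + 1) * (Fintype.card F ^ 12 - 1) := by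
  have hq : 1 ≤ Fintype.card F := Fintype.card_pos
  have hneg : (-1 : F) ≠ 0 := neg_ne_zero.mpr one_ne_zero
  have h0 : (0 : (Fin 8 → F) × (Fin 8 → F) × (Fin 8 → F)) ∈
      {p | IsAnnihilatingTriple (F := F) p.1 p.2.1 p.2.2} := by
    simp [IsAnnihilatingTriple, octN_zero, octMul_zero_left]
  rw [setOf_isWhite, Set.ncard_union_eq, Set.ncard_union_eq, (injOn_whiteVectorOne _).ncard_image,
    (injOn_whiteVectorTwo _).ncard_image, Set.ncard_image_of_injective _ injective_whiteVectorThree,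
    Set.ncard_prod, Set.ncard_prod, Set.ncard_prod, ncard_ne_zero]
  · have h1 := Set.ncard_sdiff_singleton_add_one h0
    have h2 := ncard_isAnnihilatingTriple (F := F)
    have h3 := ncard_octN_add_octN_eq_add hneg
    have h4 := ncard_octN_eq_zero_add (F := F)
    have h5 := ncard_octN_eq_add_of_ne_zero hneg
    have h6 : 1 ≤ Fintype.card F ^ 12 := Nat.one_le_pow _ _ hq
    zify [hq, h6] at h1 h3 h4 h5 ⊢
    rw [eq_sub_of_add_eq h1, h2, eq_sub_of_add_eq h3, eq_sub_of_add_eq h4, eq_sub_of_add_eq h5]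
    ring
  · rw [Set.disjoint_left]
    rintro _ ⟨⟨e, A, C⟩, ⟨he, -⟩, rfl⟩ ⟨p, -, h⟩
    simp only [whiteVectorTwo, whiteVectorThree, Prod.mk.injEq] at h
    exact he h.2.1.symm
  · rw [Set.disjoint_left]
    rintro _ ⟨⟨f, A, B⟩, ⟨hf, -⟩, rfl⟩ (⟨p, -, h⟩ | ⟨p, -, h⟩)
    · simp only [whiteVectorOne, whiteVectorTwo, Prod.mk.injEq] at h
      exact hf h.2.2.1.symm
    · simp only [whiteVectorOne, whiteVectorThree, Prod.mk.injEq] at h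
      exact hf h.2.2.1.symm

/-- A finite set of nonzero vectors closed under nonzero scalars has `q - 1` times as many elements
as it spans lines. -/
theorem ncard_eq_ncard_span_mul [Field F] [Fintype F] {V : Type*} [AddCommGroup V] [Module F V]
    [Finite V] (S : Set V) (h0 : ∀ v ∈ S, v ≠ 0) (hS : ∀ c : F, c ≠ 0 → ∀ v ∈ S, c • v ∈ S) :
    S.ncard = {P : Submodule F V | ∃ v ∈ S, P = Submodule.span F {v}}.ncard *
      (Fintype.card F - 1) := by
  classical
  have := Fintype.ofFinite V
  have himage : {P : Submodule F V | ∃ v ∈ S, P = Submodule.span F {v}} =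
      (S.toFinset.image fun v => Submodule.span F {v} : Finset (Submodule F V)) := by
    ext P
    simp [eq_comm]
  rw [himage, Set.ncard_coe_finset, Set.ncard_eq_toFinset_card',
    Finset.card_eq_sum_card_image (fun v => Submodule.span F {v}), Finset.sum_const_nat]
  intro P hP
  simp only [Finset.mem_image, Set.mem_toFinset] at hP
  obtain ⟨v, hv, rfl⟩ := hP
  rw [← ncard_ne_zero, ← Set.ncard_image_of_injective _ (smul_left_injective F (h0 v hv)),
    ← Set.ncard_coe_finset]
  congr 1
  ext w
  simp only [Finset.coe_filter, Set.mem_toFinset, Set.mem_ofPred_eq, Set.mem_image]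
  constructor
  · rintro ⟨hw, h⟩
    obtain ⟨z, hz⟩ := Submodule.span_singleton_eq_span_singleton.mp h.symm
    exact ⟨z, z.ne_zero, hz⟩
  · rintro ⟨c, hc, rfl⟩
    exact ⟨hS c hc v hv, Submodule.span_singleton_smul_eq (IsUnit.mk0 c hc) v⟩

/-- Suppose `q ≡ 2 (mod 3)`.  The set of white vectors of `U` is
invariant under multiplication by nonzero scalars, the number of white vectors
equals `(q^4 + 1)(q^{12} − 1)`, and hence the number of white points equals
`(q^4 + 1)(q^{12} − 1)/(q − 1)`. -/
theorem stmt_7 {F : Type*} [Field F] [Fintype F] (hq : Fintype.card F % 3 = 2) :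
    (∀ c : F, c ≠ 0 → ∀ v : Alb F, IsWhite v → IsWhite (c • v)) ∧
    {v : Alb F | IsWhite v}.ncard = (Fintype.card F ^ 4 + 1) * (Fintype.card F ^ 12 - 1) ∧
    (whitePoints F).ncard =
      (Fintype.card F ^ 4 + 1) * (Fintype.card F ^ 12 - 1) / (Fintype.card F - 1) := by
  refine ⟨fun c hc v hv => hv.smul hc, ncard_isWhite, ?_⟩
  have h := ncard_eq_ncard_span_mul {v : Alb F | IsWhite v} (fun _ hv => IsWhite.ne_zero hv)
    (fun c hc v hv => IsWhite.smul hc hv)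
  have hpos : 0 < Fintype.card F - 1 := Nat.sub_pos_of_lt Fintype.one_lt_card
  rw [← ncard_isWhite, h]
  exact (Nat.mul_div_cancel _ hpos).symm
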